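/- Let S and A be positive integers, γ ∈ (0,1), P ∈ ℝ^{SA×S} row-stochastic, ρ ∈ ℝ^S a probability vector, Ξ = 1_A ⊗ I_S, c ∈ ℝ^{SA}, σ > 0, w ∈ ℝ^{SA}, and let D be the occupancy polytope. Fix any φ_0 ∈ ℝ^{SA} with φ_0 ≥ 0 and define the QRPI iterates for ℓ ∈ ℕ by: V_{ℓ+1} = ((γP−Ξ)^⊤(γP−Ξ))^{-1}((γP−Ξ)^⊤(w/σ − c + φ_ℓ) + (1/σ)(1−γ)ρ), φ_{ℓ+1} = max(c + γP V_{ℓ+1} − Ξ V_{ℓ+1} − w/σ, 0), d_{ℓ+1} = σ·max(−c − γP V_{ℓ+1} + Ξ V_{ℓ+1} + w/σ, 0), with maxima taken componentwise. Then (d_ℓ, V_ℓ, φ_ℓ) converges, with (V*, φ*) a maximizer of the dual function κ over ℝ^S × {φ ≥ 0}, and d_ℓ converges to the unique minimizer d* of c^⊤ d + (1/(2σ))‖d − w‖² over D; moreover the convergence is R-linear: there exist M ≥ 0 and r ∈ [0,1) such that ‖d_ℓ − d*‖ + ‖V_ℓ − V*‖ + ‖φ_ℓ − φ*‖ ≤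 M r^ℓ for all ℓ. -/

import Mathlib

open Matrix Filter Topology

noncomputable def eucNorm {ι : Type*} [Fintype ι] (x : ι → ℝ) : ℝ :=
  Real.sqrt (∑ i, x i ^ 2)

def RowStochastic {m n : Type*} [Fintype n] (P : Matrix m n ℝ) : Prop :=
  (∀ i j, 0 ≤ P i j) ∧ ∀ i, ∑ j, P i j = 1

def Xi (S A : ℕ) : Matrix (Fin S × Fin A) (Fin S) ℝ :=
  Matrix.of fun p s' => if p.1 = s' then 1 else 0

def OccD (S A : ℕ) (γ : ℝ) (P : Matrix (Fin S × Fin A) (Fin S) ℝ)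
    (ρ : Fin S → ℝ) : Set ((Fin S × Fin A) → ℝ) :=
  {d | (∀ p, 0 ≤ d p) ∧
    ∀ s, ∑ a, d (s, a) = (1 - γ) * ρ s + γ * ∑ p : Fin S × Fin A, P p s * d p}

noncomputable def kappa (S A : ℕ) (γ σ : ℝ) (P : Matrix (Fin S × Fin A) (Fin S) ℝ)
    (ρ : Fin S → ℝ) (c w : (Fin S × Fin A) → ℝ)
    (V : Fin S → ℝ) (φ : (Fin S × Fin A) → ℝ) : ℝ :=
  -(σ / 2) * eucNorm (c + γ • P.mulVec V - (Xi S A).mulVec V - φ) ^ 2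
    + ∑ p, w p * (c + γ • P.mulVec V - (Xi S A).mulVec V - φ) p
    + (1 - γ) * ∑ s, ρ s * V s

noncomputable def regObj {ι : Type*} [Fintype ι] (σ : ℝ) (c w d : ι → ℝ) : ℝ :=
  (∑ p, c p * d p) + (1 / (2 * σ)) * eucNorm (d - w) ^ 2

/-- A nonexpansive, positively homogeneous map on a proper space contracts at a linear rate along any
orbit that tends to zero. -/
theorem isBigO_geometric_of_homogeneous {E : Type*} [NormedAddCommGroup E] [NormedSpace ℝ E]
    [ProperSpace E] {F : E → E} (hF : LipschitzWith 1 F)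
    (hhom : ∀ (t : ℝ) (x : E), 0 ≤ t → F (t • x) = t • F x) {x₀ : E}
    (hx₀ : Tendsto (fun n => F^[n] x₀) atTop (𝓝 0)) :
    ∃ r : ℝ, 0 < r ∧ r < 1 ∧ (fun n => F^[n] x₀) =O[atTop] (fun n : ℕ => r ^ n) := by
  have hlip : ∀ n, LipschitzWith 1 F^[n] := fun n => by simpa using hF.iterate n
  have hhomn : ∀ (n : ℕ) (t : ℝ) (x : E), 0 ≤ t → F^[n] (t • x) = t • F^[n] x := by
    intro n
    induction n with
    | zero => simp
    | succ n ih => intro t x ht; rw [Function.iterate_succ_apply, hhom t x ht, ih _ _ ht,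
        Function.iterate_succ_apply]
  have hF0 : F 0 = 0 := by simpa using hhom 0 0 le_rfl
  have hnorm : ∀ n x, ‖F^[n] x‖ ≤ ‖x‖ := fun n x => by
    have h := (hlip n).dist_le_mul x 0
    rw [Function.iterate_fixed hF0] at h
    simpa using h
  have hanti : ∀ {n m : ℕ} (x : E), n ≤ m → ‖F^[m] x‖ ≤ ‖F^[n] x‖ := fun {n m} x h => by
    obtain ⟨k, rfl⟩ := Nat.exists_eq_add_of_le' h
    rw [Function.iterate_add_apply]
    exact hnorm _ _
  let B : Set E := {x | Tendsto (fun n => F^[n] x) atTop (𝓝 0)}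
  have hB : IsClosed B := by
    rw [← isSeqClosed_iff_isClosed]
    intro y x hy hyx
    change Tendsto (fun n => F^[n] x) atTop (𝓝 0)
    rw [Metric.tendsto_atTop] at hyx ⊢
    intro ε hε
    obtain ⟨k, hk⟩ := hyx (ε / 2) (half_pos hε)
    obtain ⟨N, hN⟩ := Metric.tendsto_atTop.1 (hy k) (ε / 2) (half_pos hε)
    refine ⟨N, fun n hn => ?_⟩
    have h1 := (hlip n).dist_le_mul x (y k)
    have h2 := hk k le_rfl
    have h3 := hN n hn
    have h4 := dist_triangle (F^[n] x) (F^[n] (y k)) 0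
    rw [dist_comm] at h2
    simp only [NNReal.coe_one, one_mul] at h1
    linarith
  have hcpt : IsCompact (B ∩ Metric.closedBall 0 1) := (isCompact_closedBall 0 1).inter_left hB
  obtain ⟨m, hm⟩ : ∃ m : ℕ, B ∩ Metric.closedBall 0 1 ⊆ {x | ‖F^[m] x‖ < 1 / 2} := by
    refine hcpt.elim_directed_cover _
      (fun n => isOpen_lt (hlip n).continuous.norm continuous_const) ?_ ?_
    · rintro x ⟨hx, -⟩
      have := (tendsto_order.1 (tendsto_zero_iff_norm_tendsto_zero.1 hx)).2 (1 / 2) (by norm_num)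
      obtain ⟨n, hn⟩ := this.exists
      exact Set.mem_iUnion.2 ⟨n, hn⟩
    · exact Monotone.directed_le fun n k h x hx => (hanti x h).trans_lt hx
  have hBinv : ∀ n, F^[n] x₀ ∈ B := fun n => by
    have := (tendsto_add_atTop_iff_nat n).2 hx₀
    simpa only [B, Set.mem_ofPred_eq, Function.iterate_add_apply] using this
  have hhalf : ∀ x ∈ B, ‖F^[m] x‖ ≤ 1 / 2 * ‖x‖ := by
    intro x hx
    rcases eq_or_ne x 0 with rfl | hne
    · rw [Function.iterate_fixed hF0]; simp
    have hpos : 0 < ‖x‖ := norm_pos_iff.2 hne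
    have hmem : ‖x‖⁻¹ • x ∈ B ∩ Metric.closedBall 0 1 := by
      refine ⟨?_, by simp [norm_smul, hpos.ne']⟩
      have := Tendsto.const_smul hx ‖x‖⁻¹
      simp only [smul_zero] at this
      refine this.congr fun n => (hhomn n _ _ (by positivity)).symm
    have h := hm hmem
    simp only [Set.mem_ofPred_eq] at h
    rw [hhomn m _ _ (by positivity), norm_smul, norm_inv, norm_norm, inv_mul_lt_iff₀ hpos] at h
    linarith
  have hk : ∀ k, ‖F^[m * k] x₀‖ ≤ (1 / 2) ^ k * ‖x₀‖ := by
    intro k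
    induction k with
    | zero => simp
    | succ k ih =>
      rw [Nat.mul_succ, Nat.add_comm, Function.iterate_add_apply]
      have := hhalf _ (hBinv (m * k))
      rw [pow_succ]
      linarith
  let m' := m + 1
  have hk' : ∀ k, ‖F^[m' * k] x₀‖ ≤ (1 / 2) ^ k * ‖x₀‖ := fun k =>
    (hanti x₀ (Nat.mul_le_mul_right k (Nat.le_succ m))).trans (hk k)
  let r : ℝ := (1 / 2) ^ ((m' : ℝ)⁻¹)
  have hm'0 : (0 : ℝ) < m' := by positivity
  have hr0 : 0 < r := by positivity
  have hr1 : r < 1 := Real.rpow_lt_one (by norm_num) (by norm_num) (by positivity)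
  have hrm : r ^ m' = 1 / 2 := Real.rpow_inv_natCast_pow (by norm_num) (by positivity)
  refine ⟨r, hr0, hr1, Asymptotics.IsBigO.of_bound (2 * ‖x₀‖) (Eventually.of_forall fun n => ?_)⟩
  have h1 := (hanti x₀ (Nat.mul_div_le n m')).trans (hk' (n / m'))
  have h2 : (1 / 2 : ℝ) ^ (n / m') ≤ 2 * r ^ n := by
    have h3 : r ^ (m' * (n / m' + 1)) ≤ r ^ n :=
      pow_le_pow_of_le_one hr0.le hr1.le (Nat.lt_mul_div_succ n (Nat.succ_pos m)).le
    rw [pow_mul, hrm, pow_succ] at h3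
    linarith
  rw [norm_pow, Real.norm_of_nonneg hr0.le]
  nlinarith [norm_nonneg x₀]

/-- Orbits of an averaged map with a fixed point converge to a fixed point. -/
theorem exists_fixed_tendsto_of_averaged {E : Type*} [NormedAddCommGroup E] [ProperSpace E]
    {T : E → E}
    (hT : ∀ x y, ‖(x - y) - (T x - T y)‖ ^ 2 ≤ 2 * (‖x - y‖ ^ 2 - ‖T x - T y‖ ^ 2))
    {p : E} (hp : T p = p) {x : ℕ → E} (hx : ∀ n, x (n + 1) = T (x n)) :
    ∃ q, T q = q ∧ Tendsto x atTop (𝓝 q) := by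
  have hne : ∀ y z, ‖T y - T z‖ ≤ ‖y - z‖ := fun y z =>
    (pow_le_pow_iff_left₀ (norm_nonneg _) (norm_nonneg _) two_ne_zero).1 (by nlinarith [hT y z, sq_nonneg ‖(y - z) - (T y - T z)‖])
  have hcont : Continuous T :=
    (LipschitzWith.of_dist_le_mul (K := 1) fun y z => by
      simpa [dist_eq_norm] using hne y z).continuous
  have hmono : ∀ q, T q = q → Antitone fun n => ‖x n - q‖ := fun q hq =>
    antitone_nat_of_succ_le fun n => by simpa [hx, hq] using hne (x n) q
  have hreg : Tendsto (fun n => x n - T (x n)) atTop (𝓝 0) := by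
    obtain ⟨l, hl⟩ : ∃ l, Tendsto (fun n => ‖x n - p‖) atTop (𝓝 l) :=
      ⟨_, tendsto_atTop_ciInf (hmono p hp) ⟨0, by rintro _ ⟨n, rfl⟩; positivity⟩⟩
    have h1 : Tendsto (fun n => 2 * (‖x n - p‖ ^ 2 - ‖x (n + 1) - p‖ ^ 2)) atTop (𝓝 0) := by
      simpa using ((hl.pow 2).sub (((tendsto_add_atTop_iff_nat 1).2 hl).pow 2)).const_mul 2
    have h2 : Tendsto (fun n => ‖x n - T (x n)‖ ^ 2) atTop (𝓝 0) := by
      refine squeeze_zero (fun n => by positivity) (fun n => ?_) h1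
      simpa [hx, hp] using hT (x n) p
    rw [tendsto_zero_iff_norm_tendsto_zero]
    simpa [Real.sqrt_sq] using h2.sqrt
  obtain ⟨q, -, ψ, hψ, hq⟩ := tendsto_subseq_of_bounded
    (Metric.isBounded_closedBall (x := p) (r := ‖x 0 - p‖)) (x := x) fun n => by
      simpa [dist_eq_norm] using hmono p hp (Nat.zero_le n)
  have hTq : T q = q := by
    have h1 := hq.sub ((hcont.tendsto q).comp hq)
    have h2 := tendsto_nhds_unique h1 (hreg.comp hψ.tendsto_atTop)
    exact (sub_eq_zero.1 h2).symm
  refine ⟨q, hTq, ?_⟩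
  rw [tendsto_iff_norm_sub_tendsto_zero]
  refine tendsto_iff_tendsto_subseq_of_antitone (hmono q hTq) hψ.tendsto_atTop |>.2 ?_
  simpa [Function.comp_def] using (hq.sub_const q).norm

/-- Iterating an orthogonal projection, a translation and the positive part converges linearly to a
fixed point as soon as one exists. -/
theorem exists_isBigO_geometric_of_posPart_proj {ι : Type*} [Fintype ι]
    (L : EuclideanSpace ℝ ι →ₗ[ℝ] EuclideanSpace ℝ ι)
    (hL : ∀ v, inner ℝ (L v) v = ‖L v‖ ^ 2) (b : EuclideanSpace ℝ ι)
    {x : ℕ → EuclideanSpace ℝ ι} (hx : ∀ n i, x (n + 1) i = max ((L (x n) + b) i) 0)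
    {p : EuclideanSpace ℝ ι} (hp : ∀ i, p i = max ((L p + b) i) 0) :
    ∃ q : EuclideanSpace ℝ ι, (∀ i, q i = max ((L q + b) i) 0) ∧ ∃ r : ℝ, 0 < r ∧ r < 1 ∧
      (fun n => x n - q) =O[atTop] (fun n : ℕ => r ^ n) := by
  let T : EuclideanSpace ℝ ι → EuclideanSpace ℝ ι :=
    fun y => WithLp.toLp 2 fun i => max ((L y + b) i) 0
  have hpyth : ∀ v, ‖v - L v‖ ^ 2 = ‖v‖ ^ 2 - ‖L v‖ ^ 2 := fun v => by
    rw [norm_sub_sq_real, real_inner_comm, hL]; ring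
  have hLle : ∀ v, ‖L v‖ ≤ ‖v‖ := fun v =>
    (pow_le_pow_iff_left₀ (norm_nonneg _) (norm_nonneg _) two_ne_zero).1
      (by nlinarith [hpyth v, sq_nonneg ‖v - L v‖])
  have hmax : ∀ s t : ℝ, (s - t - (max s 0 - max t 0)) ^ 2 ≤
      (s - t) ^ 2 - (max s 0 - max t 0) ^ 2 := by
    intro s t
    rcases le_total s 0 with hs | hs <;> rcases le_total t 0 with ht | ht <;>
      simp only [hs, ht, max_eq_left, max_eq_right] <;> nlinarith
  have hT : ∀ y z, ‖(y - z) - (T y - T z)‖ ^ 2 ≤ 2 * (‖y - z‖ ^ 2 - ‖T y - T z‖ ^ 2) := by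
    intro y z
    have h1 := hpyth (y - z)
    have h2 : ‖L (y - z) - (T y - T z)‖ ^ 2 ≤ ‖L (y - z)‖ ^ 2 - ‖T y - T z‖ ^ 2 := by
      simp only [EuclideanSpace.real_norm_sq_eq, ← Finset.sum_sub_distrib]
      refine Finset.sum_le_sum fun i _ => ?_
      simpa [T] using hmax ((L y + b) i) ((L z + b) i)
    have h3 := parallelogram_law_with_norm ℝ ((y - z) - L (y - z)) (L (y - z) - (T y - T z))
    rw [sub_add_sub_cancel] at h3
    nlinarith [mul_self_nonneg ‖(y - z) - L (y - z) - (L (y - z) - (T y - T z))‖]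
  obtain ⟨q, hq, hlim⟩ := exists_fixed_tendsto_of_averaged hT
    (p := p) (by ext i; simp [T, hp i]) (x := x) (fun n => by ext i; exact hx n i)
  have hqi : ∀ i, q i = max ((L q + b) i) 0 := fun i => by
    conv_lhs => rw [← hq]
  let ψ : ℝ → ℝ → ℝ := fun a s => if 0 < a then s else if a < 0 then 0 else max s 0
  have hψ : ∀ a s t, |ψ a s - ψ a t| ≤ |s - t| := by
    intro a s t
    simp only [ψ]
    split_ifs
    · rfl
    · simp
    · exact abs_max_sub_max_le_abs s t 0
  let F : EuclideanSpace ℝ ι → EuclideanSpace ℝ ι :=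
    fun v => WithLp.toLp 2 fun i => ψ ((L q + b) i) (L v i)
  have hF : LipschitzWith 1 F := by
    refine LipschitzWith.of_dist_le_mul fun v z => ?_
    simp only [dist_eq_norm, NNReal.coe_one, one_mul]
    refine le_trans ?_ (hLle (v - z))
    refine (pow_le_pow_iff_left₀ (norm_nonneg _) (norm_nonneg _) two_ne_zero).1 ?_
    simp only [EuclideanSpace.real_norm_sq_eq]
    refine Finset.sum_le_sum fun i _ => sq_le_sq.2 ?_
    simpa [F] using hψ ((L q + b) i) (L v i) (L z i)
  have hhom : ∀ (t : ℝ) (v : EuclideanSpace ℝ ι), 0 ≤ t → F (t • v) = t • F v := by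
    intro t v ht
    ext i
    simp only [F, ψ, map_smul, PiLp.smul_apply, smul_eq_mul]
    split_ifs
    · rfl
    · simp
    · rw [mul_max_of_nonneg _ _ ht, mul_zero]
  have he : Tendsto (fun n => x n - q) atTop (𝓝 0) := by simpa using hlim.sub_const q
  have hlocal : ∀ᶠ n in atTop, x (n + 1) - q = F (x n - q) := by
    have hLe : Tendsto (fun n => L (x n - q)) atTop (𝓝 0) :=
      squeeze_zero_norm (fun n => hLle _) (tendsto_zero_iff_norm_tendsto_zero.1 he)
    have hcoord : ∀ i, ∀ᶠ n in atTop, (L q + b) i ≠ 0 → |L (x n - q) i| < |(L q + b) i| := by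
      intro i
      by_cases h : (L q + b) i = 0
      · simp [h]
      · have h1 : Tendsto (fun n => |L (x n - q) i|) atTop (𝓝 0) :=
          squeeze_zero (fun n => abs_nonneg _) (fun n => PiLp.norm_apply_le (L (x n - q)) i)
            (tendsto_zero_iff_norm_tendsto_zero.1 hLe)
        filter_upwards [(tendsto_order.1 h1).2 _ (abs_pos.2 h)] with n hn _ using hn
    filter_upwards [eventually_all.2 hcoord] with n hn
    ext i
    have hsplit : (L (x n) + b) i = (L q + b) i + L (x n - q) i := by
      simp only [map_sub, PiLp.add_apply, PiLp.sub_apply]; ring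
    have hni := hn i
    simp only [F, PiLp.sub_apply, hx n i, hqi i, hsplit]
    generalize (L q + b) i = a at *
    generalize L (x n - q) i = s at *
    simp only [ψ]
    split_ifs with h1 h2
    · have := hni h1.ne'
      rw [abs_of_pos h1, abs_lt] at this
      rw [max_eq_left (by linarith), max_eq_left h1.le]; ring
    · have := hni h2.ne
      rw [abs_of_neg h2, abs_lt] at this
      rw [max_eq_right (by linarith), max_eq_right h2.le]; ring
    · obtain rfl : a = 0 := le_antisymm (not_lt.1 h1) (not_lt.1 h2)
      simp
  obtain ⟨N, hN⟩ := eventually_atTop.1 hlocal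
  have horbit : ∀ n, F^[n] (x N - q) = x (n + N) - q := by
    intro n
    induction n with
    | zero => simp
    | succ n ih =>
      rw [Function.iterate_succ_apply', ih, ← hN (n + N) (Nat.le_add_left N n)]
      congr 2; ring
  obtain ⟨r, hr0, hr1, hr⟩ := isBigO_geometric_of_homogeneous hF hhom (x₀ := x N - q) <| by
    simpa only [horbit] using (tendsto_add_atTop_iff_nat N).2 he
  refine ⟨q, hqi, r, hr0, hr1, ?_⟩
  rw [← Filter.map_add_atTop_eq_nat N, Asymptotics.isBigO_map]
  simp only [horbit] at hr
  refine hr.trans (Asymptotics.IsBigO.of_bound (r ^ N)⁻¹ (Eventually.of_forall fun n => ?_))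
  have : (0 : ℝ) < r ^ N := by positivity
  simp [pow_add, abs_of_pos hr0]
  field_simp
  rfl

/-- The value function objective obtained by minimizing the negated dual over the multiplier. -/
noncomputable def reducedDual {m n : Type*} [Fintype m] [Fintype n] (σ : ℝ) (K : Matrix m n ℝ)
    (a : m → ℝ) (q V : n → ℝ) : ℝ :=
  σ / 2 * ∑ p, max (-(a + K *ᵥ V) p) 0 ^ 2 - q ⬝ᵥ V

theorem transpose_mulVec_of_reducedDual_min {m n : Type*} [Fintype m] [Fintype n] [DecidableEq n]
    {σ : ℝ} (hσ : 0 < σ) {K : Matrix m n ℝ} {a : m → ℝ} {q V : n → ℝ}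
    (hmin : ∀ V', reducedDual σ K a q V ≤ reducedDual σ K a q V') :
    Kᵀ *ᵥ (σ • fun p => max (-(a + K *ᵥ V) p) 0) = -q := by
  set d : m → ℝ := fun p => max (-(a + K *ᵥ V) p) 0 with hd
  have key : ∀ v, σ * (d ⬝ᵥ K *ᵥ v) + q ⬝ᵥ v = 0 := by
    intro v
    have hquad : ∀ t : ℝ, 0 ≤ (σ / 2 * ∑ p, (K *ᵥ v) p ^ 2) * (t * t) +
        (-(σ * (d ⬝ᵥ K *ᵥ v) + q ⬝ᵥ v)) * t + 0 := by
      intro t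
      have h1 := hmin (V + t • v)
      have h2 : ∑ p, max (-(a + K *ᵥ (V + t • v)) p) 0 ^ 2 ≤
          ∑ p, (-d p + t * (K *ᵥ v) p) ^ 2 := by
        refine Finset.sum_le_sum fun p _ => ?_
        simp only [hd, mulVec_add, mulVec_smul, Pi.add_apply, Pi.smul_apply, smul_eq_mul]
        generalize (K *ᵥ V) p = k
        generalize t * (K *ᵥ v) p = l
        rcases le_total (-(a p + k)) 0 with h | h <;>
          rcases le_total (-(a p + (k + l))) 0 with h' | h' <;>
          simp only [h, h', max_eq_left, max_eq_right] <;> nlinarith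
      have h3 : ∑ p, (-d p + t * (K *ᵥ v) p) ^ 2 =
          ∑ p, d p ^ 2 - 2 * t * (d ⬝ᵥ K *ᵥ v) + t ^ 2 * ∑ p, (K *ᵥ v) p ^ 2 := by
        simp only [dotProduct, Finset.mul_sum, ← Finset.sum_sub_distrib, ← Finset.sum_add_distrib]
        exact Finset.sum_congr rfl fun p _ => by ring
      simp only [reducedDual, dotProduct_add, dotProduct_smul, smul_eq_mul] at h1
      rw [h3] at h2
      have h4 := mul_le_mul_of_nonneg_left h2 (half_pos hσ).le
      linarith
    have := discrim_le_zero hquad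
    rw [discrim] at this
    nlinarith [sq_nonneg (σ * (d ⬝ᵥ K *ᵥ v) + q ⬝ᵥ v)]
  ext s
  have h := key (Pi.single s 1)
  rw [dotProduct_mulVec, dotProduct_single_one, dotProduct_single_one,
    ← mulVec_transpose] at h
  rw [mulVec_smul, Pi.smul_apply, smul_eq_mul, Pi.neg_apply]
  linarith

theorem bellman_mulVec {S A : ℕ} (γ : ℝ) (P : Matrix (Fin S × Fin A) (Fin S) ℝ) (V : Fin S → ℝ)
    (p : Fin S × Fin A) : ((γ • P - Xi S A) *ᵥ V) p = γ * ∑ j, P p j * V j - V p.1 := by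
  rw [sub_mulVec, smul_mulVec]
  simp [Xi, mulVec, dotProduct]

theorem bellman_transpose_mulVec {S A : ℕ} (γ : ℝ) (P : Matrix (Fin S × Fin A) (Fin S) ℝ)
    (d : Fin S × Fin A → ℝ) (s : Fin S) :
    ((γ • P - Xi S A)ᵀ *ᵥ d) s = γ * ∑ p, P p s * d p - ∑ a, d (s, a) := by
  have h : ∑ p, Xi S A p s * d p = ∑ a, d (s, a) := by
    rw [Fintype.sum_prod_type, Finset.sum_eq_single s]
    · simp [Xi]
    · intro t _ ht; simp [Xi, ht]
    · simp
  simp only [mulVec, dotProduct, transpose_apply, Matrix.sub_apply, Matrix.smul_apply,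
    smul_eq_mul, sub_mul,
    Finset.sum_sub_distrib, h, Finset.mul_sum, mul_assoc]

theorem mem_OccD_iff {S A : ℕ} {γ : ℝ} {P : Matrix (Fin S × Fin A) (Fin S) ℝ} {ρ : Fin S → ℝ}
    {d : Fin S × Fin A → ℝ} :
    d ∈ OccD S A γ P ρ ↔ 0 ≤ d ∧ (γ • P - Xi S A)ᵀ *ᵥ d = -((1 - γ) • ρ) := by
  refine and_congr Iff.rfl ?_
  rw [funext_iff]
  refine forall_congr' fun s => ?_
  rw [bellman_transpose_mulVec, Pi.neg_apply, Pi.smul_apply, smul_eq_mul]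
  constructor <;> intro h <;> linarith

theorem RowStochastic.le_sum {m n : Type*} [Fintype n] {P : Matrix m n ℝ} (hP : RowStochastic P)
    {V : n → ℝ} {k : ℝ} (h : ∀ j, k ≤ V j) (p : m) : k ≤ ∑ j, P p j * V j := by
  calc k = ∑ j, P p j * k := by rw [← Finset.sum_mul, hP.2, one_mul]
    _ ≤ _ := Finset.sum_le_sum fun j _ => mul_le_mul_of_nonneg_left (h j) (hP.1 p j)

theorem RowStochastic.sum_le {m n : Type*} [Fintype n] {P : Matrix m n ℝ} (hP : RowStochastic P)
    {V : n → ℝ} {k : ℝ} (h : ∀ j, V j ≤ k) (p : m) : ∑ j, P p j * V j ≤ k := by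
  calc _ ≤ ∑ j, P p j * k :=
        Finset.sum_le_sum fun j _ => mul_le_mul_of_nonneg_left (h j) (hP.1 p j)
    _ = k := by rw [← Finset.sum_mul, hP.2, one_mul]

theorem bellman_mulVec_injective {S A : ℕ} (hA : 0 < A) {γ : ℝ} (hγ0 : 0 < γ) (hγ1 : γ < 1)
    {P : Matrix (Fin S × Fin A) (Fin S) ℝ} (hP : RowStochastic P) :
    Function.Injective (γ • P - Xi S A).mulVec := by
  have hle : ∀ V, (γ • P - Xi S A) *ᵥ V = 0 → ∀ s, V s ≤ 0 := by
    intro V hV s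
    have : Nonempty (Fin S) := ⟨s⟩
    obtain ⟨t, ht⟩ := Finite.exists_max V
    have h1 := congrFun hV (t, ⟨0, hA⟩)
    rw [bellman_mulVec, Pi.zero_apply] at h1
    have h2 := hP.sum_le ht (t, ⟨0, hA⟩)
    have h3 := ht s
    dsimp only at h1
    nlinarith
  intro V W h
  have h0 : (γ • P - Xi S A) *ᵥ (V - W) = 0 := by rw [mulVec_sub, sub_eq_zero]; exact h
  have h0' : (γ • P - Xi S A) *ᵥ (W - V) = 0 := by rw [mulVec_sub, sub_eq_zero]; exact h.symm
  ext s
  have h1 := hle _ h0 s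
  have h2 := hle _ h0' s
  simp only [Pi.sub_apply] at h1 h2
  linarith

/-- Clipping `V` from below does not increase the objective, and a large maximal value makes it
large, so a minimizer over a suitable box is a global minimizer. -/
theorem exists_reducedDual_min {S A : ℕ} (hA : 0 < A) {γ : ℝ} (hγ0 : 0 < γ)
    (hγ1 : γ < 1) {P : Matrix (Fin S × Fin A) (Fin S) ℝ} (hP : RowStochastic P) {ρ : Fin S → ℝ}
    (hρ0 : ∀ s, 0 ≤ ρ s) (hρ1 : ∑ s, ρ s = 1) {σ : ℝ} (hσ : 0 < σ) (a : Fin S × Fin A → ℝ) :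
    ∃ V, ∀ V', reducedDual σ (γ • P - Xi S A) a ((1 - γ) • ρ) V ≤
      reducedDual σ (γ • P - Xi S A) a ((1 - γ) • ρ) V' := by
  set K := γ • P - Xi S A with hK
  set G := reducedDual σ K a ((1 - γ) • ρ) with hG
  have hG0 : 0 ≤ G 0 := by simp only [hG, reducedDual, dotProduct_zero, sub_zero]; positivity
  have hγ : 0 < 1 - γ := by linarith
  set C := ∑ p, |a p| with hC
  have hC0 : 0 ≤ C := Finset.sum_nonneg fun p _ => abs_nonneg _
  have haC : ∀ p, |a p| ≤ C := fun p =>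
    Finset.single_le_sum (f := fun p => |a p|) (fun p _ => abs_nonneg _) (Finset.mem_univ p)
  set k := C / (1 - γ) with hk
  have hk' : (1 - γ) * k = C := by rw [hk]; field_simp
  have hk0 : 0 ≤ k := by positivity
  set R := 4 / σ + G 0 + C with hR
  have hσ4 : 0 < 4 / σ := by positivity
  set M := (C + R) / (1 - γ) with hM
  have hM' : (1 - γ) * M = C + R := by rw [hM]; field_simp
  have hM0 : 0 ≤ M := by positivity
  have hcont : Continuous G := by
    simp only [hG]
    unfold reducedDual
    simp only [mulVec, dotProduct, Pi.add_apply]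
    fun_prop
  obtain ⟨V, -, hV⟩ := (isCompact_Icc (a := fun _ : Fin S => -k) (b := fun _ => M)).exists_isMinOn
    ⟨0, fun _ => by simpa using hk0, fun _ => hM0⟩ hcont.continuousOn
  have hV0 : G V ≤ G 0 := hV ⟨fun _ => by simpa using hk0, fun _ => hM0⟩
  refine ⟨V, fun V' => ?_⟩
  let W : Fin S → ℝ := fun s => max (V' s) (-k)
  have hWk : ∀ s, -k ≤ W s := fun s => le_max_right _ _
  have hWV : ∀ s, V' s ≤ W s := fun s => le_max_left _ _
  have hGW : G W ≤ G V' := by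
    have h1 : ((1 - γ) • ρ) ⬝ᵥ V' ≤ ((1 - γ) • ρ) ⬝ᵥ W :=
      Finset.sum_le_sum fun s _ =>
        mul_le_mul_of_nonneg_left (hWV s) (mul_nonneg hγ.le (hρ0 s))
    have h2 : ∑ p, max (-(a + K *ᵥ W) p) 0 ^ 2 ≤ ∑ p, max (-(a + K *ᵥ V') p) 0 ^ 2 := by
      refine Finset.sum_le_sum fun p _ => pow_le_pow_left₀ (le_max_right _ _) ?_ 2
      simp only [hK, Pi.add_apply, bellman_mulVec]
      rcases le_total (V' p.1) (-k) with h | h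
      · have hW : W p.1 = -k := max_eq_right h
        have := hP.le_sum hWk p
        have h3 := (abs_le.1 (haC p)).1
        refine max_le ((?_ : _ ≤ (0 : ℝ)).trans (le_max_right _ _)) (le_max_right _ _)
        rw [hW]
        nlinarith
      · have hW : W p.1 = V' p.1 := max_eq_left h
        have : ∑ j, P p j * V' j ≤ ∑ j, P p j * W j :=
          Finset.sum_le_sum fun j _ => mul_le_mul_of_nonneg_left (hWV j) (hP.1 p j)
        refine max_le_max ?_ le_rfl
        rw [hW]
        nlinarith
    have h3 := mul_le_mul_of_nonneg_left h2 (half_pos hσ).le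
    simp only [hG, reducedDual]
    linarith
  refine le_trans ?_ hGW
  by_cases hWM : ∀ s, W s ≤ M
  · exact hV ⟨hWk, hWM⟩
  push Not at hWM
  obtain ⟨s₀, hs₀⟩ := hWM
  have : Nonempty (Fin S) := ⟨s₀⟩
  obtain ⟨s, hs⟩ := Finite.exists_max W
  refine hV0.trans ?_
  set p : Fin S × Fin A := (s, ⟨0, hA⟩)
  set y := (1 - γ) * W s - C with hy
  have hyR : R ≤ y := by nlinarith [hs s₀]
  have h1 : y ≤ max (-(a + K *ᵥ W) p) 0 := by
    refine le_trans ?_ (le_max_left _ _)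
    simp only [hK, Pi.add_apply, bellman_mulVec]
    have h3 := (abs_le.1 (haC p)).2
    have h4 := hP.sum_le hs p
    change _ ≤ -(a p + (γ * ∑ j, P p j * W j - W s))
    nlinarith
  have h2 : y ^ 2 ≤ ∑ p, max (-(a + K *ᵥ W) p) 0 ^ 2 :=
    (pow_le_pow_left₀ (by linarith) h1 2).trans
      (Finset.single_le_sum (f := fun p => max (-(a + K *ᵥ W) p) 0 ^ 2)
        (fun p _ => by positivity) (Finset.mem_univ p))
  have h3 : ((1 - γ) • ρ) ⬝ᵥ W ≤ (1 - γ) * W s := by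
    rw [smul_dotProduct, smul_eq_mul]
    refine mul_le_mul_of_nonneg_left ?_ hγ.le
    calc ρ ⬝ᵥ W ≤ ∑ t, ρ t * W s :=
          Finset.sum_le_sum fun t _ => mul_le_mul_of_nonneg_left (hs t) (hρ0 t)
      _ = W s := by rw [← Finset.sum_mul, hρ1, one_mul]
  have h4 : 4 ≤ σ * y := by
    have : 4 / σ ≤ y := by linarith
    rw [div_le_iff₀ hσ] at this
    linarith
  have h5 := mul_le_mul_of_nonneg_left h2 (half_pos hσ).le
  have h6 : G W = σ / 2 * ∑ p, max (-(a + K *ᵥ W) p) 0 ^ 2 - ((1 - γ) • ρ) ⬝ᵥ W := rfl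
  nlinarith

theorem eucNorm_sq {ι : Type*} [Fintype ι] (x : ι → ℝ) : eucNorm x ^ 2 = x ⬝ᵥ x := by
  rw [eucNorm, Real.sq_sqrt (Finset.sum_nonneg fun i _ => sq_nonneg _)]
  simp [dotProduct, sq]

theorem eucNorm_eq_norm {ι : Type*} [Fintype ι] (x : ι → ℝ) :
    eucNorm x = ‖WithLp.toLp 2 x‖ := by
  simp [eucNorm, EuclideanSpace.norm_eq]

theorem regObj_sub_regObj {m n : Type*} [Fintype m] [Fintype n] {σ : ℝ} (hσ : 0 < σ)
    {K : Matrix m n ℝ} {c w φ d d' : m → ℝ} {V : n → ℝ}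
    (hd : d = w + σ • (φ - (c + K *ᵥ V))) (hdφ : d ⬝ᵥ φ = 0) (hK : Kᵀ *ᵥ d' = Kᵀ *ᵥ d) :
    regObj σ c w d' - regObj σ c w d = d' ⬝ᵥ φ + 1 / (2 * σ) * eucNorm (d' - d) ^ 2 := by
  have h0 : (d' - d) ⬝ᵥ K *ᵥ V = 0 := by
    rw [dotProduct_mulVec, ← mulVec_transpose, mulVec_sub, hK, sub_self, zero_dotProduct]
  have h1 : regObj σ c w d' - regObj σ c w d =
      (d' ⬝ᵥ φ - d ⬝ᵥ φ) - (d' - d) ⬝ᵥ K *ᵥ V + 1 / (2 * σ) * eucNorm (d' - d) ^ 2 := by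
    simp only [regObj, eucNorm_sq, dotProduct, Finset.mul_sum, ← Finset.sum_sub_distrib,
      ← Finset.sum_add_distrib]
    refine Finset.sum_congr rfl fun p _ => ?_
    have hφ : φ p = (d p - w p) / σ + c p + (K *ᵥ V) p := by
      rw [hd]; simp only [Pi.add_apply, Pi.smul_apply, Pi.sub_apply, smul_eq_mul]; field_simp; ring
    rw [hφ]
    simp only [Pi.sub_apply]
    field_simp
    ring
  rw [h1, h0, hdφ]; ring

theorem kappa_sub_kappa {S A : ℕ} {γ σ : ℝ}
    {P : Matrix (Fin S × Fin A) (Fin S) ℝ} {ρ : Fin S → ℝ} {c w φ d : Fin S × Fin A → ℝ}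
    {V : Fin S → ℝ} (hd : d = w + σ • (φ - (c + (γ • P - Xi S A) *ᵥ V))) (hdφ : d ⬝ᵥ φ = 0)
    (hK : (γ • P - Xi S A)ᵀ *ᵥ d = -((1 - γ) • ρ)) (V' : Fin S → ℝ) (φ' : Fin S × Fin A → ℝ) :
    kappa S A γ σ P ρ c w V φ - kappa S A γ σ P ρ c w V' φ' = d ⬝ᵥ φ' +
      σ / 2 * eucNorm ((γ • P - Xi S A) *ᵥ (V' - V) - (φ' - φ)) ^ 2 := by
  have hx : ∀ (U : Fin S → ℝ) (f : Fin S × Fin A → ℝ),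
      c + γ • P.mulVec U - (Xi S A).mulVec U - f = c + (γ • P - Xi S A) *ᵥ U - f := fun U f => by
    rw [sub_mulVec, smul_mulVec, add_sub_assoc]
  simp only [kappa, hx]
  set K := γ • P - Xi S A
  have h0 : d ⬝ᵥ K *ᵥ V' - d ⬝ᵥ K *ᵥ V = (1 - γ) * ∑ s, ρ s * V s - (1 - γ) * ∑ s, ρ s * V' s := by
    simp only [dotProduct_mulVec, ← mulVec_transpose, hK, neg_dotProduct, smul_dotProduct,
      smul_eq_mul]
    simp only [dotProduct]
    ring
  suffices h : -(σ / 2) * eucNorm (c + K *ᵥ V - φ) ^ 2 + ∑ p, w p * (c + K *ᵥ V - φ) p -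
      (-(σ / 2) * eucNorm (c + K *ᵥ V' - φ') ^ 2 + ∑ p, w p * (c + K *ᵥ V' - φ') p) =
      d ⬝ᵥ φ' - d ⬝ᵥ φ - (d ⬝ᵥ K *ᵥ V' - d ⬝ᵥ K *ᵥ V) +
      σ / 2 * eucNorm (K *ᵥ (V' - V) - (φ' - φ)) ^ 2 by
    rw [h0, hdφ] at h
    linarith
  simp only [eucNorm_sq, mulVec_sub, dotProduct, Finset.mul_sum, ← Finset.sum_sub_distrib,
    ← Finset.sum_add_distrib]
  refine Finset.sum_congr rfl fun p _ => ?_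
  rw [hd]
  simp only [Pi.add_apply, Pi.smul_apply, Pi.sub_apply, smul_eq_mul]
  ring

/-- the QRPI iterates converge R-linearly to a primal-dual
solution of the regularized MDP. -/
theorem qrpi_converges_R_linearly
    (S A : ℕ) (hS : 0 < S) (hA : 0 < A)
    (γ : ℝ) (hγ0 : 0 < γ) (hγ1 : γ < 1)
    (P : Matrix (Fin S × Fin A) (Fin S) ℝ) (hP : RowStochastic P)
    (ρ : Fin S → ℝ) (hρ0 : ∀ s, 0 ≤ ρ s) (hρ1 : ∑ s, ρ s = 1)
    (c : (Fin S × Fin A) → ℝ) (σ : ℝ) (hσ : 0 < σ) (w : (Fin S × Fin A) → ℝ)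
    (φ0 : (Fin S × Fin A) → ℝ) (hφ0 : ∀ p, 0 ≤ φ0 p)
    (V : ℕ → Fin S → ℝ) (φ d : ℕ → (Fin S × Fin A) → ℝ)
    (hinit : φ 0 = φ0)
    (hV : ∀ ℓ : ℕ, V (ℓ + 1) =
      (((γ • P - Xi S A)ᵀ * (γ • P - Xi S A))⁻¹).mulVec
        ((γ • P - Xi S A)ᵀ.mulVec ((1 / σ) • w - c + φ ℓ)
          + ((1 / σ) * (1 - γ)) • ρ))
    (hφ : ∀ ℓ : ℕ, φ (ℓ + 1) = fun p =>
      max ((c + γ • P.mulVec (V (ℓ + 1)) - (Xi S A).mulVec (V (ℓ + 1))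
        - (1 / σ) • w) p) 0)
    (hd : ∀ ℓ : ℕ, d (ℓ + 1) = σ • fun p =>
      max ((-c - γ • P.mulVec (V (ℓ + 1)) + (Xi S A).mulVec (V (ℓ + 1))
        + (1 / σ) • w) p) 0) :
    ∃ (dstar : (Fin S × Fin A) → ℝ) (Vstar : Fin S → ℝ)
      (φstar : (Fin S × Fin A) → ℝ),
      dstar ∈ OccD S A γ P ρ ∧
      (∀ d' ∈ OccD S A γ P ρ, regObj σ c w dstar ≤ regObj σ c w d') ∧
      (∀ d' ∈ OccD S A γ P ρ, d' ≠ dstar →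
        regObj σ c w dstar < regObj σ c w d') ∧
      (∀ p, 0 ≤ φstar p) ∧
      (∀ (V' : Fin S → ℝ) (φ' : (Fin S × Fin A) → ℝ), (∀ p, 0 ≤ φ' p) →
        kappa S A γ σ P ρ c w V' φ' ≤ kappa S A γ σ P ρ c w Vstar φstar) ∧
      ∃ (M r : ℝ), 0 ≤ M ∧ 0 ≤ r ∧ r < 1 ∧
        ∀ ℓ : ℕ,
          eucNorm (d ℓ - dstar) + eucNorm (V ℓ - Vstar)
            + eucNorm (φ ℓ - φstar) ≤ M * r ^ ℓ := by
  set K := γ • P - Xi S A with hKdef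
  set a : Fin S × Fin A → ℝ := c - (1 / σ) • w with ha
  set q : Fin S → ℝ := (1 - γ) • ρ with hq
  set B := (Kᵀ * K)⁻¹ with hB
  have hinj : Function.Injective K.mulVec := bellman_mulVec_injective hA hγ0 hγ1 hP
  have hunit : IsUnit (Kᵀ * K).det := by
    have := (PosDef.conjTranspose_mul_self K hinj).isUnit
    rwa [conjTranspose_eq_transpose_of_trivial, isUnit_iff_isUnit_det] at this
  have hKB : ∀ v, Kᵀ *ᵥ (K *ᵥ (B *ᵥ v)) = v := fun v => by
    rw [mulVec_mulVec, mulVec_mulVec, hB, mul_nonsing_inv _ hunit, one_mulVec]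
  have hBK : ∀ v, B *ᵥ (Kᵀ *ᵥ (K *ᵥ v)) = v := fun v => by
    rw [mulVec_mulVec, mulVec_mulVec, hB, Matrix.mul_assoc, nonsing_inv_mul _ hunit, one_mulVec]
  let U : (Fin S × Fin A → ℝ) → Fin S → ℝ := fun f => B *ᵥ (Kᵀ *ᵥ (f - a) + (1 / σ) • q)
  have hUadd : ∀ f, U f = B *ᵥ (Kᵀ *ᵥ f) + U 0 := fun f => by
    simp only [U, mulVec_add, mulVec_sub, mulVec_zero]; abel
  have hVU : ∀ ℓ, V (ℓ + 1) = U (φ ℓ) := fun ℓ => by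
    rw [hV, mul_smul]
    congr 3
    rw [ha]; abel
  have hφU : ∀ ℓ p, φ (ℓ + 1) p = max ((a + K *ᵥ V (ℓ + 1)) p) 0 := fun ℓ p => by
    rw [hφ]
    change max _ _ = _
    rw [ha, hKdef, sub_mulVec, smul_mulVec]
    simp only [Pi.add_apply, Pi.sub_apply]
    ring_nf
  have hdU : ∀ ℓ, d (ℓ + 1) = σ • fun p => max (-(a + K *ᵥ V (ℓ + 1)) p) 0 := fun ℓ => by
    rw [hd]
    congr 1
    ext p
    rw [ha, hKdef, sub_mulVec, smul_mulVec]
    simp only [Pi.add_apply, Pi.sub_apply, Pi.neg_apply]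
    ring_nf
  let L : EuclideanSpace ℝ (Fin S × Fin A) →ₗ[ℝ] EuclideanSpace ℝ (Fin S × Fin A) :=
    Matrix.toEuclideanLin (K * B * Kᵀ)
  let b : EuclideanSpace ℝ (Fin S × Fin A) := WithLp.toLp 2 (a + K *ᵥ U 0)
  have hLapply : ∀ v, L v = WithLp.toLp 2 (K *ᵥ (B *ᵥ (Kᵀ *ᵥ v.ofLp))) := fun v => by
    simp [L, toLpLin_apply, mulVec_mulVec]
  have hL : ∀ v, inner ℝ (L v) v = ‖L v‖ ^ 2 := fun v => by
    rw [← real_inner_self_eq_norm_sq, hLapply]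
    set z := B *ᵥ (Kᵀ *ᵥ v.ofLp) with hz
    simp only [EuclideanSpace.inner_eq_star_dotProduct, star_trivial]
    calc v.ofLp ⬝ᵥ K *ᵥ z = (Kᵀ *ᵥ v.ofLp) ⬝ᵥ z := by rw [dotProduct_mulVec, mulVec_transpose]
      _ = (Kᵀ *ᵥ (K *ᵥ z)) ⬝ᵥ z := by rw [hz, hKB]
      _ = (K *ᵥ z) ⬝ᵥ K *ᵥ z := by rw [mulVec_transpose, ← dotProduct_mulVec]
  have hLb : ∀ (f : Fin S × Fin A → ℝ) p,
      (L (WithLp.toLp 2 f) + b) p = (a + K *ᵥ U f) p := fun f p => by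
    rw [hLapply, hUadd f, mulVec_add]
    simp only [b, PiLp.add_apply, Pi.add_apply]
    ring
  obtain ⟨V₀, hV₀⟩ := exists_reducedDual_min hA hγ0 hγ1 hP hρ0 hρ1 hσ a
  have hposneg : ∀ s : ℝ, max s 0 = s + max (-s) 0 := fun s => by
    rcases le_total s 0 with h | h <;> simp [h]
  have hfix₀ : U (fun p => max ((a + K *ᵥ V₀) p) 0) = V₀ := by
    have h1 := transpose_mulVec_of_reducedDual_min hσ hV₀
    rw [mulVec_smul] at h1
    have h2 : (fun p => max ((a + K *ᵥ V₀) p) 0) - a =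
        K *ᵥ V₀ + fun p => max (-(a + K *ᵥ V₀) p) 0 := by
      ext p
      simp only [Pi.sub_apply, Pi.add_apply, hposneg (a p + (K *ᵥ V₀) p)]
      ring
    have h3 : (Kᵀ *ᵥ fun p => max (-(a + K *ᵥ V₀) p) 0) = -((1 / σ) • q) := by
      rw [← smul_neg, ← h1, smul_smul, one_div_mul_cancel hσ.ne', one_smul]
    simp only [U]
    rw [h2, mulVec_add Kᵀ, h3, neg_add_cancel_right, hBK]
  obtain ⟨φs, hφs, r, hr0, hr1, hr⟩ := exists_isBigO_geometric_of_posPart_proj L hL b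
    (x := fun n => WithLp.toLp 2 (φ n)) (fun n p => by rw [hLb, ← hVU]; exact hφU n p)
    (p := WithLp.toLp 2 fun p => max ((a + K *ᵥ V₀) p) 0)
    (fun p => by rw [hLb, hfix₀])
  obtain ⟨φstar, rfl⟩ : ∃ f, φs = WithLp.toLp 2 f := ⟨φs.ofLp, rfl⟩
  simp only [hLb] at hφs
  set Vstar := U φstar with hVstar
  set dstar : Fin S × Fin A → ℝ := σ • fun p => max (-(a + K *ᵥ Vstar) p) 0 with hdstar
  have hφ_nonneg : 0 ≤ φstar := fun p => (hφs p).symm ▸ le_max_right _ _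
  have hd_nonneg : 0 ≤ dstar := fun p => mul_nonneg hσ.le (le_max_right _ _)
  have hdrep : dstar = w + σ • (φstar - (c + K *ᵥ Vstar)) := by
    ext p
    simp only [hdstar, Pi.add_apply, Pi.smul_apply, Pi.sub_apply, smul_eq_mul]
    rw [hφs p, hposneg]
    simp only [ha, Pi.add_apply, Pi.sub_apply, Pi.smul_apply, smul_eq_mul]
    field_simp
    ring
  have hcompl : dstar ⬝ᵥ φstar = 0 := Finset.sum_eq_zero fun p _ => by
    rw [hdstar, Pi.smul_apply, hφs p]
    generalize (a + K *ᵥ Vstar) p = t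
    rcases le_total t 0 with h | h <;> simp [h]
  have hfeas : Kᵀ *ᵥ dstar = -q := by
    have h1 : Kᵀ *ᵥ (K *ᵥ Vstar) = Kᵀ *ᵥ (φstar - a) + (1 / σ) • q := hKB _
    have h2 : dstar = σ • ((φstar - a) - K *ᵥ Vstar) := by
      rw [hdrep, ha]
      ext p
      simp only [Pi.add_apply, Pi.smul_apply, Pi.sub_apply, smul_eq_mul]
      field_simp
      ring
    rw [h2, mulVec_smul, mulVec_sub, h1, sub_add_cancel_left, smul_neg, smul_smul,
      mul_one_div_cancel hσ.ne', one_smul]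
  have hgap : ∀ d' ∈ OccD S A γ P ρ, 1 / (2 * σ) * eucNorm (d' - dstar) ^ 2 ≤
      regObj σ c w d' - regObj σ c w dstar := fun d' hd' => by
    rw [mem_OccD_iff] at hd'
    rw [regObj_sub_regObj hσ hdrep hcompl (hd'.2.trans hfeas.symm)]
    have : 0 ≤ d' ⬝ᵥ φstar := dotProduct_nonneg_of_nonneg hd'.1 hφ_nonneg
    linarith
  refine ⟨dstar, Vstar, φstar, mem_OccD_iff.2 ⟨hd_nonneg, hfeas⟩, fun d' hd' => ?_,
    fun d' hd' hne => ?_, hφ_nonneg, fun V' φ' hφ' => ?_, ?_⟩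
  · have h1 := hgap d' hd'
    have : 0 ≤ 1 / (2 * σ) * eucNorm (d' - dstar) ^ 2 := by positivity
    linarith
  · have h1 := hgap d' hd'
    have h2 : 0 < eucNorm (d' - dstar) := by
      rw [eucNorm_eq_norm, norm_pos_iff]
      simpa [sub_eq_zero] using hne
    have : 0 < 1 / (2 * σ) * eucNorm (d' - dstar) ^ 2 := by positivity
    linarith
  · have h1 := kappa_sub_kappa hdrep hcompl hfeas V' φ'
    have h2 : 0 ≤ dstar ⬝ᵥ φ' := dotProduct_nonneg_of_nonneg hd_nonneg hφ'
    have h3 : 0 ≤ σ / 2 * eucNorm (K *ᵥ (V' - Vstar) - (φ' - φstar)) ^ 2 := by positivity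
    linarith
  have hφO : (fun n => φ n - φstar) =O[atTop] (fun n : ℕ => r ^ n) :=
    ((EuclideanSpace.equiv (Fin S × Fin A) ℝ).toContinuousLinearMap.isBigO_comp _ atTop).trans hr
  have hshift : ∀ {ι : Type} [Fintype ι] (f : ℕ → ι → ℝ),
      (fun n => f (n + 1)) =O[atTop] (fun n : ℕ => r ^ n) → f =O[atTop] (fun n : ℕ => r ^ n) := by
    intro ι _ f hf
    rw [← Filter.map_add_atTop_eq_nat 1, Asymptotics.isBigO_map]
    simpa [Function.comp_def, pow_succ, mul_comm] using hf.trans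
      (Asymptotics.isBigO_self_const_mul hr0.ne' (fun n : ℕ => r ^ n) atTop)
  have hVO : (fun n => V (n + 1) - Vstar) =O[atTop] (fun n : ℕ => r ^ n) := by
    have h := ((B * Kᵀ).mulVecLin.toContinuousLinearMap.isBigO_comp
      (fun n => φ n - φstar) atTop).trans hφO
    refine h.congr_left fun n => ?_
    simp [hVU, hVstar, hUadd (φ n), hUadd φstar, mulVec_sub, mulVec_transpose]
  have hdO : (fun n => d (n + 1) - dstar) =O[atTop] (fun n : ℕ => r ^ n) := by
    refine Asymptotics.IsBigO.trans (Asymptotics.IsBigO.of_bound σ (Eventually.of_forall fun n => ?_))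
      ((K.mulVecLin.toContinuousLinearMap.isBigO_comp
        (fun n => V (n + 1) - Vstar) atTop).trans hVO)
    rw [hdU, hdstar, ← smul_sub, norm_smul, Real.norm_of_nonneg hσ.le]
    refine mul_le_mul_of_nonneg_left ((pi_norm_le_iff_of_nonneg (norm_nonneg _)).2 fun p => ?_) hσ.le
    refine le_trans ?_ (norm_le_pi_norm _ p)
    refine (abs_max_sub_max_le_abs _ _ _).trans_eq ?_
    rw [Real.norm_eq_abs, abs_sub_comm]
    congr 1
    simp only [mulVec_sub, Pi.add_apply, Pi.sub_apply, LinearMap.coe_toContinuousLinearMap',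
      mulVecLin_apply]
    ring
  have hnorm : ∀ {ι : Type} [Fintype ι] {f : ℕ → ι → ℝ}, f =O[atTop] (fun n : ℕ => r ^ n) →
      (fun n => eucNorm (f n)) =O[atTop] (fun n : ℕ => r ^ n) := by
    intro ι _ f hf
    simp only [eucNorm_eq_norm]
    exact (((EuclideanSpace.equiv ι ℝ).symm.toContinuousLinearMap.isBigO_comp f atTop).trans
      hf).norm_left
  obtain ⟨M, hM0, hM⟩ := Asymptotics.bound_of_isBigO_nat_atTop
    (((hnorm (hshift (fun n => d n - dstar) hdO)).add (hnorm (hshift (fun n => V n - Vstar) hVO))).add (hnorm hφO))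
  refine ⟨M, r, hM0.le, hr0.le, hr1, fun ℓ => ?_⟩
  have h := hM (pow_pos hr0 ℓ).ne'
  rw [Real.norm_of_nonneg (pow_pos hr0 ℓ).le] at h
  exact (le_abs_self _).trans h
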